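/- Assume conditions (C_g)(a) (with d > c > 0) and (C_{f_n})(a)(b), fix κ⁺ ∈ (0, 1−ξ₁), let x⁺ be as in the standing definition with t₂ the second time with x⁺(t₂) = 1, and assume condition (Y_n). Let m ∈ ℕ with m > t₂ be such that x⁺(t) < 1 for all t ∈ (t₂, m]. Then sup_{j ∈ J_n} max_{t ∈ [0,m]} |Y^{+,n,j}(t) − x⁺(t)| → 0 as n → ∞. -/

import Mathlib

open Real Set Filter Topology MeasureTheory

noncomputable section

/-- Condition `(C_g)(a)`: `g` maps `[0,∞)` into `[0,1]`, the restriction of `g` to `[0,1]`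
is `C¹` with derivative `g'` (one-sided at the endpoints), `g = 0` on `(1,∞)`,
`g 0 = g' 0 = 0`, `g 1 = 1`, and `g' ξ > g ξ / ξ` for all `ξ ∈ (0,1]`. -/
structure CgA (g g' : ℝ → ℝ) : Prop where
  maps_to : ∀ ξ : ℝ, 0 ≤ ξ → g ξ ∈ Icc (0:ℝ) 1
  hasDeriv : ∀ ξ ∈ Icc (0:ℝ) 1, HasDerivWithinAt g (g' ξ) (Icc (0:ℝ) 1) ξ
  derivCont : ContinuousOn g' (Icc (0:ℝ) 1)
  eq_zero : ∀ ξ : ℝ, 1 < ξ → g ξ = 0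
  g_zero : g 0 = 0
  g'_zero : g' 0 = 0
  g_one : g 1 = 1
  slope : ∀ ξ : ℝ, 0 < ξ → ξ ≤ 1 → g ξ / ξ < g' ξ

/-- `x` is a (nonnegative, continuous) solution on `ℝ` of the delay equation
`x'(t) = -a·x(t) + b·F(x(t-1))`, in integral form. -/
def IsSolR (a b : ℝ) (F x : ℝ → ℝ) : Prop :=
  Continuous x ∧ (∀ t : ℝ, 0 ≤ x t) ∧
    ∀ τ t : ℝ, τ < t →
      IntervalIntegrable (fun s => Real.exp (-a * (t - s)) * F (x (s - 1))) volume τ t ∧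
      x t = Real.exp (-a * (t - τ)) * x τ
          + b * ∫ s in τ..t, Real.exp (-a * (t - s)) * F (x (s - 1))

/-- `x` is a (nonnegative, continuous) solution on `[T₁ - 1, ∞)` of the delay equation
`x'(t) = -a·x(t) + b·F(x(t-1))`, in integral form (identity for `T₁ ≤ τ < t`). -/
def IsSolOn (a b : ℝ) (F : ℝ → ℝ) (T₁ : ℝ) (x : ℝ → ℝ) : Prop :=
  ContinuousOn x (Ici (T₁ - 1)) ∧ (∀ t : ℝ, T₁ - 1 ≤ t → 0 ≤ x t) ∧
    ∀ τ t : ℝ, T₁ ≤ τ → τ < t →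
      IntervalIntegrable (fun s => Real.exp (-a * (t - s)) * F (x (s - 1))) volume τ t ∧
      x t = Real.exp (-a * (t - τ)) * x τ
          + b * ∫ s in τ..t, Real.exp (-a * (t - s)) * F (x (s - 1))

/-- `z` is the solution of `(E_g)` on `[0,∞)` with initial segment `z t = e^{-c t}` on `[0,1]`. -/
def IsZSol (c d : ℝ) (g z : ℝ → ℝ) : Prop :=
  IsSolOn c d g 1 z ∧ ∀ t ∈ Icc (0:ℝ) 1, z t = Real.exp (-c * t)

/-- Condition `(C_{f_n})(a)(b)`: `a n → c`, `b n → d`, each `f n : [0,∞) → [0,1)` is `C¹`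
with derivative `f' n`, `f n 0 = 0`, `f' n > 0` on `(0,1/2]`, the uniform closeness of
`(f n, f' n)` to `(g, g')` away from `1`, and the smallness of
`sup_{[1+κ,∞)}|f' n| · (sup_{[0,∞)}|f' n|)^m`. -/
structure Cfn (c d : ℝ) (g g' : ℝ → ℝ) (a b : ℕ → ℝ) (f f' : ℕ → ℝ → ℝ) : Prop where
  a_pos : ∀ n, 0 < a n
  b_pos : ∀ n, 0 < b n
  a_lim : Tendsto a atTop (nhds c)
  b_lim : Tendsto b atTop (nhds d)
  maps_to : ∀ n, ∀ ξ : ℝ, 0 ≤ ξ → f n ξ ∈ Ico (0:ℝ) 1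
  hasDeriv : ∀ n, ∀ ξ : ℝ, 0 ≤ ξ → HasDerivWithinAt (f n) (f' n ξ) (Ici (0:ℝ)) ξ
  derivCont : ∀ n, ContinuousOn (f' n) (Ici (0:ℝ))
  f_zero : ∀ n, f n 0 = 0
  f'_pos : ∀ n, ∀ ξ : ℝ, 0 < ξ → ξ ≤ 1/2 → 0 < f' n ξ
  close : ∀ κ : ℝ, 0 < κ → κ < 1 → ∀ ε : ℝ, 0 < ε → ∃ N : ℕ, ∀ n ≥ N,
      ∀ ξ : ℝ, (ξ ∈ Icc (0:ℝ) (1 - κ) ∨ 1 + κ ≤ ξ) →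
        |f n ξ - g ξ| + |f' n ξ - g' ξ| < ε
  small : ∀ κ : ℝ, 0 < κ → κ < 1 → ∀ m : ℕ, ∃ A B : ℕ → ℝ,
      (∀ n, ∀ ξ : ℝ, 1 + κ ≤ ξ → |f' n ξ| ≤ A n) ∧
      (∀ n, ∀ ξ : ℝ, 0 ≤ ξ → |f' n ξ| ≤ B n) ∧
      Tendsto (fun n => A n * (B n) ^ m) atTop (nhds 0)

/-- Condition `(H)`. -/
structure CondH (a b ξm ξp : ℝ) (h : ℝ → ℝ) : Prop where
  a_pos : 0 < a
  b_pos : 0 < b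
  ξm_neg : ξm < 0
  ξp_pos : 0 < ξp
  bdd : ∃ M : ℝ, ∀ ξ : ℝ, |h ξ| ≤ M
  smooth : ContDiff ℝ 1 h
  h_zero : h 0 = 0
  slope_zero : a < b * deriv h 0
  zero_m : -a * ξm + b * h ξm = 0
  zero_p : -a * ξp + b * h ξp = 0
  ratio : ∀ ξ : ℝ, ξm < ξ → ξ < ξp → ξ ≠ 0 → a / b < h ξ / ξ
  deriv_pos : ∀ ξ : ℝ, ξ ≠ ξm → ξ ≠ ξp → 0 < deriv h ξ

/-- Solution of `(E_h)`: `u'(t) = -a·u(t) + b·h(u(t-1))` on all of `ℝ`. -/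
def IsSolH (a b : ℝ) (h u : ℝ → ℝ) : Prop :=
  ∀ t : ℝ, HasDerivAt u (-a * u t + b * h (u (t - 1))) t

/-- Solution of `(E_h)` on `[-1,∞)`: continuous there, differentiable on `(0,∞)`
and satisfying the equation for `t > 0`. -/
def IsSolHOn (a b : ℝ) (h u : ℝ → ℝ) : Prop :=
  ContinuousOn u (Ici (-1:ℝ)) ∧
    ∀ t : ℝ, 0 < t → HasDerivAt u (-a * u t + b * h (u (t - 1))) t

/-- Solution of `(E_h)` on `(-∞,0]`. -/
def IsSolHIic (a b : ℝ) (h u : ℝ → ℝ) : Prop :=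
  ContinuousOn u (Iic (0:ℝ)) ∧
    ∀ t : ℝ, t ≤ 0 → HasDerivWithinAt u (-a * u t + b * h (u (t - 1))) (Iic (0:ℝ)) t


theorem barrier_aux (σ A : ℝ → ℝ) (β : ℝ) (T : ℝ)
    (hd : ∀ t, t < T → HasDerivAt σ (A t * (σ (t-1) - σ t)) t)
    (hA : ∀ t, t < T → 0 ≤ A t ∧ A t ≤ β) (t m : ℝ) (ht : t + 1 < T)
    (hm : ∀ s ∈ Icc (t-1) t, m ≤ σ s) (hmt : m < σ t) :
    ∀ s ∈ Icc t (t+1), m + (σ t - m) * Real.exp (-(β+1)) ≤ σ s := by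
  have hβ : 0 ≤ β := (hA t (by linarith)).1.trans (hA t (by linarith)).2
  have key := image_le_of_deriv_right_lt_deriv_boundary'
    (f := fun s => m + (σ t - m) * Real.exp (-(β+1)*(s-t)))
    (f' := fun s => (σ t - m) * (Real.exp (-(β+1)*(s-t)) * (-(β+1))))
    (B := σ) (B' := fun s => A s * (σ (s-1) - σ s)) (a := t) (b := t+1)
    (by fun_prop) (by
      intro s hs
      have h1 : HasDerivAt (fun s:ℝ => -(β+1)*(s-t)) (-(β+1)) s := by
        simpa using ((hasDerivAt_id s).sub_const t).const_mul (-(β+1))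
      exact ((h1.exp.const_mul (σ t - m)).const_add m).hasDerivWithinAt)
    (by simp) (by
      intro s hs
      exact (hd s (by linarith [hs.2])).continuousAt.continuousWithinAt)
    (by
      intro s hs
      exact (hd s (by linarith [hs.2])).hasDerivWithinAt)
    (by
      intro s hs he
      have hsm := hm (s-1) ⟨by linarith [hs.1], by linarith [hs.2]⟩
      obtain ⟨hA0, hA1⟩ := hA s (by linarith [hs.2])
      have hE : 0 < (σ t - m) * Real.exp (-(β+1)*(s-t)) := mul_pos (by linarith) (Real.exp_pos _)
      set E := (σ t - m) * Real.exp (-(β+1)*(s-t)) with hEdef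
      have e1 : (σ t - m) * (Real.exp (-(β+1)*(s-t)) * (-(β+1))) = -(β+1) * E := by
        rw [hEdef]; ring
      rw [e1, ← he]
      nlinarith [mul_nonneg hA0 (sub_nonneg.2 hsm), mul_nonneg (sub_nonneg.2 hA1) hE.le])
  intro s hs
  refine le_trans ?_ (key hs)
  have : Real.exp (-(β+1)) ≤ Real.exp (-(β+1)*(s-t)) := by
    apply Real.exp_le_exp.2
    nlinarith [hs.1, hs.2]
  have := mul_le_mul_of_nonneg_left this (by linarith : 0 ≤ σ t - m)
  simpa using this

theorem low_aux (σ A : ℝ → ℝ) (β : ℝ) (T : ℝ)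
    (hd : ∀ t, t < T → HasDerivAt σ (A t * (σ (t-1) - σ t)) t)
    (hA : ∀ t, t < T → 0 ≤ A t ∧ A t ≤ β) (t m : ℝ) (ht : t + 1 < T)
    (hm : ∀ s ∈ Icc (t-1) t, m ≤ σ s)  :
    ∀ s ∈ Icc t (t+1), m + (σ t - m) * Real.exp (-(β+1)) ≤ σ s := by
  intro s hs
  have h0 := hm t ⟨by linarith, le_rfl⟩
  rcases h0.lt_or_eq with h | h
  · exact barrier_aux σ A β T hd hA t m ht hm h s hs
  · have : ∀ m' < m, m' ≤ σ s := by
      intro m' hm'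
      have := barrier_aux σ A β T hd hA t m' ht (fun s hs => hm'.le.trans (hm s hs)) (by linarith) s hs
      have h2 : 0 ≤ (σ t - m') * Real.exp (-(β+1)) := mul_nonneg (by linarith) (Real.exp_pos _).le
      linarith
    rw [← h]; simp
    exact le_of_forall_lt_imp_le_of_dense this

theorem avg_const (σ A : ℝ → ℝ) (β K : ℝ) (T : ℝ)
    (hd : ∀ t, t < T → HasDerivAt σ (A t * (σ (t-1) - σ t)) t)
    (hA : ∀ t, t < T → 0 ≤ A t ∧ A t ≤ β)
    (hK : ∀ s t, s < T → t < T → |s - t| ≤ 1 → |σ s - σ t| ≤ K) :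
    ∀ s t, s < T → t < T → σ s = σ t := by
  set θ := 1 - Real.exp (-(β+1)) / 2 with hθ
  have he0 := Real.exp_pos (-(β+1))
  have hβ : 0 ≤ β := (hA (T-1) (by linarith)).1.trans (hA (T-1) (by linarith)).2
  have he1 : Real.exp (-(β+1)) < 1 := by
    rw [Real.exp_lt_one_iff]; linarith
  have main : ∀ n : ℕ, ∀ t, t < T → ∀ s ∈ Icc (t-1) t, ∀ s' ∈ Icc (t-1) t,
      σ s - σ s' ≤ θ^n * K := by
    intro n
    induction n with
    | zero =>
      intro t ht s hs s' hs'
      have := hK s s' (by linarith [hs.2]) (by linarith [hs'.2])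
        (by rw [abs_le]; constructor <;> linarith [hs.1, hs.2, hs'.1, hs'.2])
      simpa using (le_abs_self _).trans this
    | succ n ih =>
      intro t ht s hs s' hs'
      have hcont : ContinuousOn σ (Icc (t-1-1) (t-1)) := fun r hr =>
        (hd r (by linarith [hr.2])).continuousAt.continuousWithinAt
      have hne : (Icc (t-1-1) (t-1)).Nonempty := ⟨t-1, by constructor <;> linarith⟩
      obtain ⟨p, hp, hpm⟩ := isCompact_Icc.exists_isMinOn hne hcont
      obtain ⟨r, hr, hrm⟩ := isCompact_Icc.exists_isMaxOn hne hcont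
      have hosc := ih (t-1) (by linarith) r hr p hp
      have hlow := low_aux σ A β T hd hA (t-1) (σ p) (by linarith) (fun s hs => hpm hs)
      have hup := low_aux (fun s => -σ s) A β T
        (fun t ht => by
          exact (hd t ht).fun_neg.congr_deriv (by ring)) hA (t-1) (-σ r) (by linarith)
          (fun s hs => neg_le_neg (hrm hs))
      have l := hlow s' (by simpa using hs')
      have u := hup s (by simpa using hs)
      rw [pow_succ]
      have h1 : σ p ≤ σ (t-1) := hpm ⟨by linarith, le_rfl⟩
      have h2 : σ (t-1) ≤ σ r := hrm ⟨by linarith, le_rfl⟩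
      have : σ s - σ s' ≤ θ * (σ r - σ p) + 0 := by
        rw [hθ]
        nlinarith
      have h3 : θ * (σ r - σ p) ≤ θ * (θ^n*K) := mul_le_mul_of_nonneg_left hosc (by rw [hθ]; linarith)
      nlinarith
  have win : ∀ t, t < T → ∀ s ∈ Icc (t-1) t, σ s = σ t := by
    intro t ht s hs
    have lim : Tendsto (fun n : ℕ => θ^n * K) atTop (𝓝 0) := by
      have := (tendsto_pow_atTop_nhds_zero_of_lt_one (r := θ) (by rw [hθ]; linarith) (by rw [hθ]; linarith)).mul_const K
      simpa using this
    have htt : t ∈ Icc (t-1) t := ⟨by linarith, le_rfl⟩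
    have a1 := ge_of_tendsto' lim (fun n => main n t ht s hs t htt)
    have a2 := ge_of_tendsto' lim (fun n => main n t ht t htt s hs)
    linarith
  have : ∀ n : ℕ, ∀ s t, t < T → s ≤ t → t - s ≤ n → σ s = σ t := by
    intro n
    induction n with
    | zero => intro s t ht hst h; have : s = t := by push_cast at h; linarith
              rw [this]
    | succ n ih =>
      intro s t ht hst h
      push_cast at h
      rcases le_total (t - s) 1 with h1 | h1
      · exact win t ht s ⟨by linarith, hst⟩
      · rw [ih s (t-1) (by linarith) (by linarith) (by linarith)]
        exact win t ht (t-1) ⟨le_rfl, by linarith⟩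
  intro s t hs ht
  rcases le_total s t with h | h
  · obtain ⟨n, hn⟩ := exists_nat_ge (t - s)
    exact this n s t ht h hn
  · obtain ⟨n, hn⟩ := exists_nat_ge (s - t)
    exact (this n t s hs h hn).symm

/-- Harnack -/
theorem harnack (c Q T : ℝ) (hc : 0 < c) (hQ : 0 ≤ Q) (u B : ℝ → ℝ)
    (hd : ∀ t, t ≤ T → HasDerivAt u (-c * u t + B t) t)
    (hB : ∀ t, t ≤ T → 0 ≤ B t ∧ B t ≤ Q * u (t-1)) :
    (∀ s t, s ≤ t → t ≤ T → u s ≤ Real.exp (c * (t-s)) * u t) ∧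
    (∀ s t, s ≤ t → t ≤ s + 1 → t ≤ T → 0 ≤ u s → u t ≤ (1 + Q * Real.exp c) * u s) := by
  have hP : ∀ t, t ≤ T → HasDerivAt (fun s => Real.exp (c*s) * u s) (Real.exp (c*t) * B t) t := by
    intro t ht
    have h1 : HasDerivAt (fun s:ℝ => c*s) c t := by
      simpa using (hasDerivAt_id t).const_mul c
    exact (h1.exp.fun_mul (hd t ht)).congr_deriv (by ring)
  have mono : MonotoneOn (fun s => Real.exp (c*s) * u s) (Iic T) := by
    apply monotoneOn_of_hasDerivWithinAt_nonneg (convex_Iic T) (f' := fun t => Real.exp (c*t) * B t)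
    · exact fun t ht => (hP t ht).continuousAt.continuousWithinAt
    · intro t ht
      rw [interior_Iic] at ht
      exact (hP t ht.le).hasDerivWithinAt
    · intro t ht
      rw [interior_Iic] at ht
      exact mul_nonneg (Real.exp_pos _).le (hB t ht.le).1
  refine ⟨?_, ?_⟩
  · intro s t hst ht
    have := mono (mem_Iic.2 (hst.trans ht)) (mem_Iic.2 ht) hst
    simp only at this
    have e : c * t = c * (t-s) + c*s := by ring
    rw [e, Real.exp_add] at this
    have h0 := Real.exp_pos (c*s)
    by_contra hcon
    push Not at hcon
    nlinarith [mul_lt_mul_of_pos_left hcon h0]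
  · intro s t hst hts ht hu
    -- P t - P s ≤ Q e^c P s
    have hPs : 0 ≤ Real.exp (c*s) * u s := mul_nonneg (Real.exp_pos _).le hu
    have hbd : ∀ r ∈ Icc s t, Real.exp (c*r) * B r ≤ Q * Real.exp c * (Real.exp (c*s) * u s) := by
      intro r hr
      have h1 := (hB r (hr.2.trans ht)).2
      have h2 := mono (mem_Iic.2 (by linarith [hr.2] : r - 1 ≤ T)) (mem_Iic.2 (hst.trans ht)) (by linarith [hr.2])
      simp only at h2
      have e : Real.exp (c*r) = Real.exp c * Real.exp (c*(r-1)) := by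
        rw [← Real.exp_add]; congr 1; ring
      calc _ ≤ Real.exp (c*r) * (Q * u (r-1)) := mul_le_mul_of_nonneg_left h1 (Real.exp_pos _).le
        _ = Q * Real.exp c * (Real.exp (c*(r-1)) * u (r-1)) := by rw [e]; ring
        _ ≤ _ := mul_le_mul_of_nonneg_left h2 (mul_nonneg hQ (Real.exp_pos _).le)
    have := image_le_of_deriv_right_le_deriv_boundary (f := fun s => Real.exp (c*s) * u s)
      (f' := fun t => Real.exp (c*t) * B t) (a := s) (b := t)
      (B := fun r => Real.exp (c*s) * u s + Q * Real.exp c * (Real.exp (c*s) * u s) * (r - s))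
      (B' := fun r => Q * Real.exp c * (Real.exp (c*s) * u s))
      (fun r hr => (hP r (hr.2.trans ht)).continuousAt.continuousWithinAt)
      (fun r hr => (hP r (hr.2.le.trans ht)).hasDerivWithinAt)
      (by simp) (by fun_prop)
      (fun r hr => by
        have := (((hasDerivAt_id r).sub_const s).const_mul (Q * Real.exp c * (Real.exp (c*s) * u s))).const_add (Real.exp (c*s) * u s)
        simpa using this.hasDerivWithinAt)
      (fun r hr => hbd r ⟨hr.1, hr.2.le⟩) (right_mem_Icc.2 hst)
    have hK : 0 ≤ Q * Real.exp c * (Real.exp (c*s) * u s) := mul_nonneg (mul_nonneg hQ (Real.exp_pos _).le) hPs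
    have h3 : Real.exp (c*t) * u t ≤ (1 + Q * Real.exp c) * (Real.exp (c*s) * u s) := by nlinarith
    have h4 : Real.exp (c*s) ≤ Real.exp (c*t) := Real.exp_le_exp.2 (by nlinarith)
    have h5 := Real.exp_pos (c*t)
    have h6 : 0 ≤ (1 + Q * Real.exp c) * u s := mul_nonneg (by positivity) hu
    by_contra hcon
    push Not at hcon
    nlinarith [mul_lt_mul_of_pos_left hcon h5, mul_le_mul_of_nonneg_right h4 h6]

theorem growth (c μ T : ℝ) (hc : 0 < c) (hμ : 0 < μ) (W H : ℝ → ℝ)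
    (hd : ∀ t, t ≤ T → HasDerivAt W (-c * W t + H t) t)
    (hm : MonotoneOn W (Iic T)) (hH : ∀ t, t ≤ T → (c+μ) * W (t-1) ≤ H t)
    :
    ∃ γ, 1 < γ ∧ ∀ t, t ≤ T → γ * W (t-2) ≤ W t := by
  have he : Real.exp (-c) < 1 := by rw [Real.exp_lt_one_iff]; linarith
  refine ⟨1 + (μ/c) * (1 - Real.exp (-c)), by
    have : 0 < (μ/c) * (1 - Real.exp (-c)) := by apply mul_pos (div_pos hμ hc); linarith
    linarith, ?_⟩
  intro t ht
  set k := (c+μ)/c * W (t-2) with hk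
  have hP : ∀ s, s ≤ T → HasDerivAt (fun s => Real.exp (c*s) * (W s - k)) (Real.exp (c*s) * (H s - c*k)) s := by
    intro t ht
    have h1 : HasDerivAt (fun s:ℝ => c*s) c t := by
      simpa using (hasDerivAt_id t).const_mul c
    exact (h1.exp.fun_mul ((hd t ht).sub_const k)).congr_deriv (by ring)
  have hck : c * k = (c+μ) * W (t-2) := by rw [hk]; field_simp
  have mono : MonotoneOn (fun s => Real.exp (c*s) * (W s - k)) (Icc (t-1) t) := by
    apply monotoneOn_of_hasDerivWithinAt_nonneg (convex_Icc _ _) (f' := fun s => Real.exp (c*s) * (H s - c*k))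
    · exact fun s hs => (hP s (hs.2.trans ht)).continuousAt.continuousWithinAt
    · intro s hs
      rw [interior_Icc] at hs
      exact (hP s (hs.2.le.trans ht)).hasDerivWithinAt
    · intro s hs
      rw [interior_Icc] at hs
      have h1 := hH s (hs.2.le.trans ht)
      have h2 := hm (mem_Iic.2 (by linarith : t-2 ≤ T)) (mem_Iic.2 (by linarith [hs.2] : s-1 ≤ T)) (by linarith [hs.1])
      refine mul_nonneg (Real.exp_pos _).le ?_
      rw [hck]
      nlinarith
  have h1 := mono (left_mem_Icc.2 (by linarith)) (right_mem_Icc.2 (by linarith)) (by linarith : t - 1 ≤ t)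
  simp only at h1
  have h2 := hm (mem_Iic.2 (by linarith : t-2 ≤ T)) (mem_Iic.2 (by linarith : t-1 ≤ T)) (by linarith)
  have e : Real.exp (c*(t-1)) = Real.exp (c*t) * Real.exp (-c) := by
    rw [← Real.exp_add]; congr 1; ring
  rw [e] at h1
  have h3 := Real.exp_pos (c*t)
  have h4 : Real.exp (-c) * (W (t-1) - k) ≤ W t - k := by
    by_contra hcon
    push Not at hcon
    nlinarith [mul_lt_mul_of_pos_left hcon h3]
  have h5 : Real.exp (-c) * (W (t-2) - k) ≤ Real.exp (-c) * (W (t-1) - k) :=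
    mul_le_mul_of_nonneg_left (by linarith) (Real.exp_pos _).le
  have hk2 : k = W (t-2) + μ/c * W (t-2) := by rw [hk]; field_simp
  rw [hk2] at h4 h5
  linarith


theorem uniq (c μ Q κ : ℝ) (hc : 0 < c) (hμ : 0 < μ) (hQ : 0 ≤ Q) (hκ : 0 < κ) (h W V : ℝ → ℝ)
    (h0 : h 0 = 0)
    (hL : ∀ u v, 0 ≤ u → u ≤ v → v ≤ κ → 0 ≤ h v - h u ∧ h v - h u ≤ Q * (v - u))
    (hg : ∀ w, 0 ≤ w → w ≤ κ → (c + μ) * w ≤ h w)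
    (hWm : StrictMonoOn W (Iic 1)) (hW0 : W 0 = κ) (hWn : ∀ t, t ≤ 1 → 0 ≤ W t)
    (hWd : ∀ t, t ≤ 1 → HasDerivAt W (-c * W t + h (W (t-1))) t)
    (hVd : ∀ t, t ≤ 0 → HasDerivAt V (-c * V t + h (V (t-1))) t)
    (hV : ∀ t, t ≤ 0 → 0 ≤ V t ∧ V t ≤ κ) (hV0 : V 0 = κ) :
    ∀ t, t ≤ 0 → V t = W t := by
  have hWK : ∀ t, t ≤ 0 → W t ≤ κ := by
    intro t ht
    rw [← hW0]
    exact hWm.monotoneOn (mem_Iic.2 (by linarith)) (mem_Iic.2 (by norm_num)) ht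
  have hh : ∀ w, 0 ≤ w → w ≤ κ → 0 ≤ h w ∧ h w ≤ Q * w := by
    intro w h1 h2
    have := hL 0 w le_rfl h1 h2
    rw [h0] at this; simpa using this
  set C0 := 1 + Q * Real.exp c with hC0
  have hC01 : 1 ≤ C0 := by
    have : 0 ≤ Q * Real.exp c := mul_nonneg hQ (Real.exp_pos _).le
    linarith
  obtain ⟨HV1, HV2⟩ := harnack c Q 0 hc hQ V (fun t => h (V (t-1))) hVd
    (fun t ht => hh _ (hV _ (by linarith)).1 (hV _ (by linarith)).2)
  obtain ⟨γ, hγ1, hγ⟩ := growth c μ 1 hc hμ W (fun t => h (W (t-1))) hWd hWm.monotoneOn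
    (fun t ht => hg _ (hWn _ (by linarith)) (hWK _ (by linarith)))
  have hγN : ∀ N : ℕ, ∀ t, t ≤ 1 → γ^N * W (t - 2*N) ≤ W t := by
    intro N
    induction N with
    | zero => intro t ht; simp
    | succ N ih =>
      intro t ht
      have h1 := hγ t ht
      have h2 := ih (t-2) (by linarith)
      have e : t - 2 - 2*(N:ℝ) = t - 2 * ((N+1 : ℕ) : ℝ) := by push_cast; ring
      rw [e] at h2
      calc _ = γ * (γ^N * W (t - 2 * ((N+1 : ℕ) : ℝ))) := by ring
        _ ≤ γ * W (t-2) := mul_le_mul_of_nonneg_left h2 (by linarith)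
        _ ≤ _ := h1
  have Wpos : ∀ t, t ≤ 1 → 0 < W t := fun t ht =>
    (hWn (t-1) (by linarith)).trans_lt (hWm (mem_Iic.2 (by linarith)) (mem_Iic.2 ht) (by linarith))
  have Vpos' : ∀ n : ℕ, ∀ t : ℝ, t ≤ 0 → -t ≤ n → 0 < V t := by
    intro n
    induction n with
    | zero => intro t ht h1
              have : t = 0 := by push_cast at h1; linarith
              rw [this, hV0]; exact hκ
    | succ n ih =>
      intro t ht h1
      push_cast at h1
      have key : ∀ s, t ≤ s → s ≤ t + 1 → s ≤ 0 → 0 < V s → 0 < V t := by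
        intro s a1 a2 a3 a4
        have := HV2 t s a1 a2 a3 (hV t ht).1
        by_contra hcon
        have : V t = 0 := le_antisymm (not_lt.1 hcon) (hV t ht).1
        simp [this] at *
        linarith
      rcases le_total (t+1) 0 with h2 | h2
      · exact key (t+1) (by linarith) le_rfl h2 (ih (t+1) h2 (by linarith))
      · exact key 0 ht h2 le_rfl (by rw [hV0]; exact hκ)
  have Vpos : ∀ t, t ≤ 0 → 0 < V t := by
    intro t ht
    obtain ⟨n, hn⟩ := exists_nat_ge (-t)
    exact Vpos' n t ht hn
  set dW : ℝ → ℝ := fun t => -c * W t + h (W (t-1)) with hdW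
  have dlim : ∀ t, t ≤ 1 → Tendsto (fun s => s⁻¹ * (W t - W (t-s))) (𝓝[>] 0) (𝓝 (dW t)) := by
    intro t ht
    have h1 : HasDerivAt (fun s => -W (t - s)) (dW t) 0 := by
      have h2 : HasDerivAt W (dW t) (t - 0) := by rw [sub_zero]; exact hWd t ht
      have := (h2.comp_const_sub t 0).fun_neg
      simpa using this
    have := h1.tendsto_slope_zero_right
    refine this.congr (fun s => ?_)
    simp; left; ring
  have HD : ∀ s, 0 < s → (∀ r t, r ≤ t → t ≤ 1 → W r - W (r-s) ≤ Real.exp (c * (t-r)) * (W t - W (t-s))) ∧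
    (∀ r t, r ≤ t → t ≤ r + 1 → t ≤ 1 → 0 ≤ W r - W (r-s) → W t - W (t-s) ≤ C0 * (W r - W (r-s))) := by
    intro s hs
    refine harnack c Q 1 hc hQ (fun t => W t - W (t-s)) (fun t => h (W (t-1)) - h (W (t-1-s))) ?_ ?_
    · intro t ht
      have h1 := (hWd (t-s) (by linarith)).comp_sub_const t s
      have e : t - s - 1 = t - 1 - s := by ring
      rw [e] at h1
      exact ((hWd t ht).fun_sub h1).congr_deriv (by ring)
    · intro t ht
      exact hL _ _ (hWn _ (by linarith)) (hWm.monotoneOn (mem_Iic.2 (by linarith)) (mem_Iic.2 (by linarith)) (by linarith))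
        (hWK _ (by linarith))
  have Dnn : ∀ s, 0 < s → ∀ t, t ≤ 1 → 0 ≤ W t - W (t-s) := by
    intro s hs t ht
    exact sub_nonneg.2 (hWm.monotoneOn (mem_Iic.2 (by linarith)) (mem_Iic.2 ht) (by linarith))
  have d1 : ∀ r t, r ≤ t → t ≤ 1 → dW r ≤ Real.exp (c * (t-r)) * dW t := by
    intro r t hrt ht
    refine le_of_tendsto_of_tendsto (dlim r (hrt.trans ht)) ((dlim t ht).const_mul _) ?_
    filter_upwards [self_mem_nhdsWithin] with s hs
    have hs' : 0 < s := hs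
    have := mul_le_mul_of_nonneg_left ((HD s hs').1 r t hrt ht) (inv_nonneg.2 hs'.le)
    linarith
  have d2 : ∀ t, t ≤ 1 → dW t ≤ C0 * dW (t-1) := by
    intro t ht
    refine le_of_tendsto_of_tendsto (dlim t ht) ((dlim (t-1) (by linarith)).const_mul _) ?_
    filter_upwards [self_mem_nhdsWithin] with s hs
    have hs' : 0 < s := hs
    have := mul_le_mul_of_nonneg_left ((HD s hs').2 (t-1) t (by linarith) (by linarith) ht
      (Dnn s hs' _ (by linarith))) (inv_nonneg.2 hs'.le)
    linarith
  have dnn : ∀ t, t ≤ 1 → 0 ≤ dW t := by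
    intro t ht
    refine ge_of_tendsto (dlim t ht) ?_
    filter_upwards [self_mem_nhdsWithin] with s hs
    have hs' : 0 < s := hs
    exact mul_nonneg (inv_nonneg.2 hs'.le) (Dnn s hs' t ht)
  have dpos : ∀ t, t ≤ 1 → 0 < dW t := by
    intro t ht
    rcases (dnn t ht).lt_or_eq with h1 | h1
    · exact h1
    · exfalso
      obtain ⟨mid, hmid, he⟩ := exists_hasDerivAt_eq_slope W dW (by linarith : t - 1 < t)
        (fun s hs => (hWd s (hs.2.trans ht)).continuousAt.continuousWithinAt)
        (fun s hs => hWd s (hs.2.le.trans ht))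
      have h2 := d1 mid t hmid.2.le ht
      rw [← h1, he] at h2
      have h3 := hWm (mem_Iic.2 (by linarith)) (mem_Iic.2 ht) (by linarith : t - 1 < t)
      have e : t - (t-1) = 1 := by ring
      rw [e] at h2
      simp at h2
      linarith
  have d2N : ∀ N : ℕ, ∀ t, t ≤ 1 → dW t ≤ C0^N * dW (t - N) := by
    intro N
    induction N with
    | zero => intro t ht; simp
    | succ N ih =>
      intro t ht
      have h2 := ih (t-1) (by linarith)
      have e : t - 1 - (N:ℝ) = t - ((N+1 : ℕ) : ℝ) := by push_cast; ring
      rw [e] at h2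
      calc _ ≤ C0 * dW (t-1) := d2 t ht
        _ ≤ C0 * (C0^N * dW (t - ((N+1 : ℕ) : ℝ))) := mul_le_mul_of_nonneg_left h2 (by linarith)
        _ = _ := by ring
  -- inverse
  have hex : ∀ v, v ∈ Ioo 0 (W 1) → ∃ τ, τ < 1 ∧ W τ = v := by
    intro v hv
    obtain ⟨n, hn⟩ := pow_unbounded_of_one_lt (W 1 / v) hγ1
    have h1 := hγN n 1 le_rfl
    rw [div_lt_iff₀ hv.1] at hn
    have hp : 0 < γ^n := pow_pos (by linarith) n
    have h2 : W (1 - 2*n) < v := by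
      by_contra hcon
      have := mul_le_mul_of_nonneg_left (not_lt.1 hcon) hp.le
      linarith
    have h3 : (1 - 2*(n:ℝ)) ≤ 1 := by have := Nat.cast_nonneg (α := ℝ) n; linarith
    obtain ⟨τ, hτ, e⟩ := intermediate_value_Ioo h3
      (fun s hs => (hWd s hs.2).continuousAt.continuousWithinAt) (⟨h2, hv.2⟩ : v ∈ Ioo _ _)
    exact ⟨τ, hτ.2, e⟩
  choose! ω hω using hex
  have hωc : ∀ v, v ∈ Ioo 0 (W 1) → ContinuousAt ω v := by
    intro v hv
    have hnb : ∀ᶠ v' in 𝓝 v, v' ∈ Ioo 0 (W 1) := Ioo_mem_nhds hv.1 hv.2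
    have hv1 := hω v hv
    refine tendsto_order.2 ⟨?_, ?_⟩
    · intro p hp
      have : W p < v := by
        rw [← hv1.2]
        exact hWm (mem_Iic.2 (by linarith)) (mem_Iic.2 hv1.1.le) hp
      filter_upwards [hnb, eventually_gt_nhds this] with v' a1 a2
      rw [← (hω v' a1).2] at a2
      exact (hWm.lt_iff_lt (mem_Iic.2 (by linarith)) (mem_Iic.2 (hω v' a1).1.le)).1 a2
    · intro p hp
      have : v < W (min p 1) := by
        nth_rewrite 1 [← hv1.2]
        exact hWm (mem_Iic.2 hv1.1.le) (mem_Iic.2 (min_le_right _ _)) (lt_min hp hv1.1)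
      filter_upwards [hnb, eventually_lt_nhds this] with v' a1 a2
      rw [← (hω v' a1).2] at a2
      have := (hWm.lt_iff_lt (mem_Iic.2 (hω v' a1).1.le) (mem_Iic.2 (min_le_right _ _))).1 a2
      exact this.trans_le (min_le_left _ _)
  have hωd : ∀ v, v ∈ Ioo 0 (W 1) → HasDerivAt ω (dW (ω v))⁻¹ v := by
    intro v hv
    have hnb : ∀ᶠ v' in 𝓝 v, v' ∈ Ioo 0 (W 1) := Ioo_mem_nhds hv.1 hv.2
    refine HasDerivAt.of_local_left_inverse (hωc v hv) (hWd _ (hω v hv).1.le) (dpos _ (hω v hv).1.le).ne' ?_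
    filter_upwards [hnb] with v' a1
    exact (hω v' a1).2
  have hVI : ∀ t, t ≤ 0 → V t ∈ Ioo 0 (W 1) := by
    intro t ht
    refine ⟨Vpos t ht, (hV t ht).2.trans_lt ?_⟩
    rw [← hW0]
    exact hWm (mem_Iic.2 (by norm_num)) (mem_Iic.2 le_rfl) (by norm_num)
  set φ : ℝ → ℝ := fun t => ω (V t) with hφ
  have hWφ : ∀ t, t ≤ 0 → W (φ t) = V t := fun t ht => (hω _ (hVI t ht)).2
  have hφ0 : ∀ t, t ≤ 0 → φ t ≤ 0 := by
    intro t ht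
    refine (hWm.le_iff_le (mem_Iic.2 (hω _ (hVI t ht)).1.le) (mem_Iic.2 (by norm_num))).1 ?_
    rw [hW0]
    have := hWφ t ht
    simp only [hφ] at this
    rw [this]
    exact (hV t ht).2
  -- oscillation bound
  set C := C0 + Real.exp c with hC
  have hVC : ∀ s t, s ≤ 0 → t ≤ 0 → |s - t| ≤ 1 → V s ≤ C * V t := by
    intro s t hs ht hst
    rw [abs_le] at hst
    have hVt := Vpos t ht
    rcases le_total s t with h1 | h1
    · have := HV1 s t h1 ht
      have h2 : Real.exp (c*(t-s)) ≤ Real.exp c := Real.exp_le_exp.2 (by nlinarith)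
      have h3 := mul_le_mul_of_nonneg_right h2 hVt.le
      have h4 : 0 ≤ C0 * V t := by positivity
      rw [hC]; linarith
    · have := HV2 t s h1 (by linarith) hs hVt.le
      have h4 : 0 ≤ Real.exp c * V t := by positivity
      rw [hC]; linarith
  obtain ⟨N, hN⟩ := pow_unbounded_of_one_lt C hγ1
  have hosc : ∀ s t, s ≤ 0 → t ≤ 0 → |s - t| ≤ 1 → φ s ≤ φ t + 2*N := by
    intro s t hs ht hst
    by_contra hcon
    push Not at hcon
    have a1 := hφ0 s hs
    have a2 := hWm (mem_Iic.2 (by linarith)) (mem_Iic.2 (by linarith)) hcon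
    have a3 := hγN N (φ t + 2*N) (by linarith)
    have e : φ t + 2*(N:ℝ) - 2*N = φ t := by ring
    rw [e, hWφ t ht] at a3
    rw [hWφ s hs] at a2
    have a4 := hVC s t hs ht hst
    have a5 := mul_lt_mul_of_pos_right hN (Vpos t ht)
    linarith
  set σ : ℝ → ℝ := fun t => φ t - t with hσ
  set G := C0^(2*N) * Real.exp (c * (4*N+1)) with hG
  have dwb : ∀ τ mid : ℝ, τ ≤ 1 → mid ≤ 1 → mid ≤ τ + 2*N → τ ≤ mid + 2*N+1 → dW mid ≤ G * dW τ := by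
    intro τ mid h1 h2 h3 h4
    have a1 := d2N (2*N) mid h2
    push_cast at a1
    have a2 := d1 (mid - 2*N) τ (by linarith) h1
    have a3 : Real.exp (c*(τ - (mid - 2*N))) ≤ Real.exp (c * (4*N+1)) :=
      Real.exp_le_exp.2 (by nlinarith)
    have a4 := mul_le_mul_of_nonneg_right a3 (dnn τ h1)
    have hp : 0 ≤ C0^(2*N) := by positivity
    calc _ ≤ _ := a1
      _ ≤ C0^(2*N) * (Real.exp (c * (4*N+1)) * dW τ) := mul_le_mul_of_nonneg_left (a2.trans a4) hp
      _ = _ := by rw [hG]; ring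
  have hnum : ∀ τ p r : ℝ, τ ≤ 0 → p < r → r ≤ 0 → r ≤ τ + 2*N → τ ≤ p + 2*N+1 →
      0 ≤ h (W r) - h (W p) ∧ h (W r) - h (W p) ≤ (Q * G) * (dW τ * (r - p)) := by
    intro τ p r h1 h2 h3 h4 h5
    have hm := hWm.monotoneOn (mem_Iic.2 (by linarith)) (mem_Iic.2 (by linarith)) h2.le
    have a1 := hL (W p) (W r) (hWn _ (by linarith)) hm (hWK _ h3)
    refine ⟨a1.1, a1.2.trans ?_⟩
    obtain ⟨mid, hmid, he⟩ := exists_hasDerivAt_eq_slope W dW h2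
        (fun s hs => (hWd s (by linarith [hs.2])).continuousAt.continuousWithinAt)
        (fun s hs => hWd s (by linarith [hs.2]))
    have hrp : 0 < r - p := by linarith
    rw [eq_div_iff hrp.ne'] at he
    rw [← he, mul_assoc]
    refine mul_le_mul_of_nonneg_left ?_ hQ
    rw [← mul_assoc]
    exact mul_le_mul_of_nonneg_right (dwb τ mid (by linarith) (by linarith [hmid.2]) (by linarith [hmid.2]) (by linarith [hmid.1])) hrp.le
  set A : ℝ → ℝ := fun t => if σ (t-1) = σ t then 0 else
    (h (V (t-1)) - h (W (φ t - 1))) / (dW (φ t) * (σ (t-1) - σ t)) with hAdef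
  have hsd : ∀ t, t < 0 → HasDerivAt σ (A t * (σ (t-1) - σ t)) t := by
    intro t ht
    have hdp := dpos (φ t) (by linarith [hφ0 t ht.le])
    have h1 : HasDerivAt σ ((dW (φ t))⁻¹ * (-c * V t + h (V (t-1))) - 1) t :=
      ((hωd (V t) (hVI t ht.le)).comp t (hVd t ht.le)).sub (hasDerivAt_id t)
    refine h1.congr_deriv ?_
    have e1 : (dW (φ t))⁻¹ * (-c * V t + h (V (t-1))) - 1 = (h (V (t-1)) - h (W (φ t - 1))) / dW (φ t) := by
      have : dW (φ t) = -c * V t + h (W (φ t - 1)) := by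
        simp only [hdW]; rw [hWφ t ht.le]
      field_simp
      rw [this]; ring
    rw [e1]
    simp only [hAdef]
    split_ifs with hs
    · have : φ t - 1 = φ (t-1) := by
        simp only [hσ] at hs; linarith
      rw [this, hWφ (t-1) (by linarith)]; simp
    · have : σ (t-1) - σ t ≠ 0 := sub_ne_zero.2 hs
      field_simp
  have hAb : ∀ t, t < 0 → 0 ≤ A t ∧ A t ≤ Q * G := by
    intro t ht
    have hG0 : 0 ≤ Q * G := by positivity
    have hdp := dpos (φ t) (by linarith [hφ0 t ht.le])
    have o1 := hosc (t-1) t (by linarith) ht.le (by simp)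
    have o2 := hosc t (t-1) ht.le (by linarith) (by simp)
    have p1 := hφ0 t ht.le
    have p2 := hφ0 (t-1) (by linarith)
    have hNn := Nat.cast_nonneg (α := ℝ) N
    simp only [hAdef]
    split_ifs with hs
    · exact ⟨le_rfl, hG0⟩
    · have e : σ (t-1) - σ t = φ (t-1) - (φ t - 1) := by simp only [hσ]; ring
      have hne : σ (t-1) - σ t ≠ 0 := sub_ne_zero.2 hs
      rw [e] at hne ⊢
      rw [← hWφ (t-1) (by linarith)]
      rcases lt_or_gt_of_ne (sub_ne_zero.1 hne) with hlt | hlt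
      · have := hnum (φ t) (φ (t-1)) (φ t - 1) p1 hlt (by linarith) (by linarith) (by linarith)
        have hpos : 0 < dW (φ t) * (φ t - 1 - φ (t-1)) := mul_pos hdp (by linarith)
        have e2 : (h (W (φ (t-1))) - h (W (φ t - 1))) / (dW (φ t) * (φ (t-1) - (φ t - 1))) =
          (h (W (φ t - 1)) - h (W (φ (t-1)))) / (dW (φ t) * (φ t - 1 - φ (t-1))) := by
          rw [← neg_div_neg_eq]; congr 1 <;> ring
        rw [e2]
        exact ⟨div_nonneg this.1 hpos.le, (div_le_iff₀ hpos).2 this.2⟩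
      · have := hnum (φ t) (φ t - 1) (φ (t-1)) p1 hlt (by linarith) (by linarith) (by linarith)
        have hpos : 0 < dW (φ t) * (φ (t-1) - (φ t - 1)) := mul_pos hdp (by linarith)
        exact ⟨div_nonneg this.1 hpos.le, (div_le_iff₀ hpos).2 this.2⟩
  have hconst := avg_const σ A (Q*G) (2*N+1) 0 hsd hAb (by
    intro s t hs ht hst
    have o1 := hosc s t hs.le ht.le hst
    have o2 := hosc t s ht.le hs.le (by rwa [abs_sub_comm])
    rw [abs_le] at hst ⊢
    simp only [hσ]
    constructor <;> linarith)
  set s0 := σ (-1) with hs0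
  have hVW : ∀ t, t < 0 → V t = W (t + s0) := by
    intro t ht
    have := hconst t (-1) ht (by norm_num)
    rw [← hWφ t ht.le]
    congr 1
    have e : σ t = φ t - t := rfl
    linarith
  have hs0n : s0 ≤ 0 := by
    by_contra hcon
    push Not at hcon
    have hh1 := hconst (-s0/2) (-1) (by linarith) (by norm_num)
    have hh2 := hφ0 (-s0/2) (by linarith)
    have e : σ (-s0/2) = φ (-s0/2) - (-s0/2) := rfl
    linarith
  have hVc : ContinuousAt V 0 := (hVd 0 le_rfl).continuousAt
  have hWc : ContinuousAt (fun t => W (t + s0)) 0 := by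
    have : ContinuousAt W (0 + s0) := (hWd _ (by linarith)).continuousAt
    exact ContinuousAt.comp (f := fun t => t + s0) this (by fun_prop)
  have l1 : Tendsto V (𝓝[<] 0) (𝓝 (V 0)) := hVc.tendsto.mono_left nhdsWithin_le_nhds
  have l2 : Tendsto V (𝓝[<] 0) (𝓝 (W (0+s0))) := by
    refine (hWc.tendsto.mono_left nhdsWithin_le_nhds).congr' ?_
    filter_upwards [self_mem_nhdsWithin] with t ht
    exact (hVW t ht).symm
  have l3 := tendsto_nhds_unique l1 l2
  rw [hV0, ← hW0] at l3
  have l4 := hWm.injOn (mem_Iic.2 (by norm_num)) (mem_Iic.2 (by linarith)) l3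
  have hs00 : s0 = 0 := by linarith
  intro t ht
  rcases ht.lt_or_eq with h1 | h1
  · rw [hVW t h1, hs00, add_zero]
  · rw [h1, hV0, hW0]


theorem g_hasDerivAt {g g' : ℝ → ℝ} (hg : CgA g g') (ξ : ℝ) (h0 : 0 < ξ) (h1 : ξ < 1) :
    HasDerivAt g (g' ξ) ξ :=
  (hg.hasDeriv ξ ⟨h0.le, h1.le⟩).hasDerivAt (Icc_mem_nhds h0 h1)

theorem g_contOn {g g' : ℝ → ℝ} (hg : CgA g g') : ContinuousOn g (Icc 0 1) :=
  fun ξ hξ => (hg.hasDeriv ξ hξ).continuousWithinAt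

theorem g_facts {g g' : ℝ → ℝ} (hg : CgA g g') (c d ξ₁ κ : ℝ) (hc : 0 < c) (hcd : c < d)
    (hξ₁ : ξ₁ ∈ Ioo (0:ℝ) 1) (hz₁ : -c * ξ₁ + d * g ξ₁ = 0) (hκ : ξ₁ + κ < 1) :
    ∃ μ Q, 0 < μ ∧ 0 ≤ Q ∧
      (∀ u v, 0 ≤ u → u ≤ v → v ≤ κ → 0 ≤ d * (g (ξ₁ + v) - g ξ₁) - d * (g (ξ₁ + u) - g ξ₁) ∧
        d * (g (ξ₁ + v) - g ξ₁) - d * (g (ξ₁ + u) - g ξ₁) ≤ Q * (v - u)) ∧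
      (∀ w, 0 ≤ w → w ≤ κ → (c + μ) * w ≤ d * (g (ξ₁ + w) - g ξ₁)) := by
  have hd : 0 < d := hc.trans hcd
  obtain ⟨Q, hQ⟩ := isCompact_Icc.exists_bound_of_continuousOn hg.derivCont
  have hQ0 : 0 ≤ Q := (norm_nonneg _).trans (hQ 0 (by simp))
  have hsub : Icc ξ₁ 1 ⊆ Icc 0 1 := Icc_subset_Icc_left hξ₁.1.le
  have hcq : ContinuousOn (fun ξ => g ξ / ξ) (Icc ξ₁ 1) :=
    ((g_contOn hg).mono hsub).div continuousOn_id (fun x hx => (hξ₁.1.trans_le hx.1).ne')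
  have hcont : ContinuousOn (fun ξ => g' ξ - g ξ / ξ) (Icc ξ₁ 1) := (hg.derivCont.mono hsub).sub hcq
  obtain ⟨p, hp, hpm⟩ := isCompact_Icc.exists_isMinOn (nonempty_Icc.2 hξ₁.2.le) hcont
  set ν := g' p - g p / p with hν
  have hνpos : 0 < ν := sub_pos.2 (hg.slope p (hξ₁.1.trans_le hp.1) hp.2)
  have hmonoq : MonotoneOn (fun ξ => g ξ / ξ) (Icc ξ₁ 1) := by
    apply monotoneOn_of_hasDerivWithinAt_nonneg (convex_Icc _ _) (f' := fun ξ => (g' ξ * ξ - g ξ * 1) / ξ^2) hcq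
    · intro ξ hξ
      rw [interior_Icc] at hξ
      have h0 : 0 < ξ := hξ₁.1.trans hξ.1
      exact ((g_hasDerivAt hg ξ h0 hξ.2).fun_div (hasDerivAt_id ξ) h0.ne').hasDerivWithinAt
    · intro ξ hξ
      rw [interior_Icc] at hξ
      have h0 : 0 < ξ := hξ₁.1.trans hξ.1
      have := hg.slope ξ h0 hξ.2.le
      rw [div_lt_iff₀ h0] at this
      apply div_nonneg _ (by positivity)
      linarith
  have hq1 : g ξ₁ / ξ₁ = c / d := by
    have := hξ₁.1
    field_simp
    linarith
  have hk : MonotoneOn (fun ξ => g ξ - (c/d + ν) * ξ) (Icc ξ₁ 1) := by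
    apply monotoneOn_of_hasDerivWithinAt_nonneg (convex_Icc _ _) (f' := fun ξ => g' ξ - (c/d+ν) * 1)
    · exact ((g_contOn hg).mono hsub).sub (by fun_prop)
    · intro ξ hξ
      rw [interior_Icc] at hξ
      have h0 : 0 < ξ := hξ₁.1.trans hξ.1
      exact ((g_hasDerivAt hg ξ h0 hξ.2).fun_sub ((hasDerivAt_id ξ).const_mul _)).hasDerivWithinAt
    · intro ξ hξ
      rw [interior_Icc] at hξ
      have a1 := hmonoq (left_mem_Icc.2 hξ₁.2.le) ⟨hξ.1.le, hξ.2.le⟩ hξ.1.le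
      have a2 : ν ≤ g' ξ - g ξ / ξ := hpm ⟨hξ.1.le, hξ.2.le⟩
      simp only [hq1] at a1
      linarith
  refine ⟨d * ν, d * Q, mul_pos hd hνpos, mul_nonneg hd.le hQ0, ?_, ?_⟩
  · intro u v hu huv hv
    rcases huv.lt_or_eq with hlt | heq
    · obtain ⟨mid, hmid, he⟩ := exists_hasDerivAt_eq_slope g g' (by linarith : ξ₁ + u < ξ₁ + v)
        ((g_contOn hg).mono (Icc_subset_Icc (by linarith [hξ₁.1]) (by linarith)))
        (fun s hs => g_hasDerivAt hg s (by linarith [hξ₁.1, hs.1]) (by linarith [hs.2]))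
      have hm0 : 0 < mid := by linarith [hξ₁.1, hmid.1]
      have hm1 : mid ≤ 1 := by linarith [hmid.2]
      have b1 : 0 ≤ g' mid := (div_nonneg (hg.maps_to mid hm0.le).1 hm0.le).trans (hg.slope mid hm0 hm1).le
      have b2 : g' mid ≤ Q := (le_abs_self _).trans (hQ mid ⟨hm0.le, hm1⟩)
      have huv' : 0 < v - u := by linarith
      have e : ξ₁ + v - (ξ₁ + u) = v - u := by ring
      rw [e, eq_div_iff huv'.ne'] at he
      have e2 : d * (g (ξ₁ + v) - g ξ₁) - d * (g (ξ₁ + u) - g ξ₁) = d * (g' mid * (v-u)) := by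
        rw [he]; ring
      rw [e2, mul_assoc]
      exact ⟨by positivity, by gcongr⟩
    · rw [heq]; simp
  · intro w hw hwκ
    have := hk (left_mem_Icc.2 hξ₁.2.le) (⟨by linarith, by linarith⟩ : ξ₁ + w ∈ Icc ξ₁ 1) (by linarith)
    simp only at this
    have h2 : (c/d + ν) * w ≤ g (ξ₁ + w) - g ξ₁ := by linarith
    have h3 := mul_le_mul_of_nonneg_left h2 hd.le
    have e : d * ((c/d + ν) * w) = (c + d*ν) * w := by field_simp
    linarith

theorem deriv_of_int (a b T : ℝ) (F x : ℝ → ℝ)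
    (hcont : ContinuousOn (fun s => F (x (s-1))) (Iio T))
    (hx : ∀ τ t, τ < t → t < T → x t = Real.exp (-a * (t - τ)) * x τ
          + b * ∫ s in τ..t, Real.exp (-a * (t - s)) * F (x (s - 1))) :
    ∀ t, t < T → HasDerivAt x (-a * x t + b * F (x (t-1))) t := by
  intro t ht
  set τ := t - 1 with hτ
  have hτt : τ < t := by linarith
  have hc2 : ContinuousOn (fun s => Real.exp (a * (s - τ)) * F (x (s-1))) (Iio T) :=
    ContinuousOn.mul (by fun_prop) hcont
  have hI : HasDerivAt (fun r => ∫ s in τ..r, Real.exp (a * (s - τ)) * F (x (s - 1)))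
      (Real.exp (a * (t - τ)) * F (x (t - 1))) t := by
    apply intervalIntegral.integral_hasDerivAt_right
    · apply ContinuousOn.intervalIntegrable
      apply hc2.mono
      rw [uIcc_of_le hτt.le]
      exact fun s hs => hs.2.trans_lt ht
    · exact ContinuousOn.stronglyMeasurableAtFilter isOpen_Iio hc2 t ht
    · exact hc2.continuousAt (Iio_mem_nhds ht)
  have hE : HasDerivAt (fun r : ℝ => Real.exp (-a * (r - τ))) (Real.exp (-a * (t - τ)) * (-a)) t := by
    have h1 : HasDerivAt (fun r:ℝ => -a * (r - τ)) (-a) t := by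
      simpa using ((hasDerivAt_id t).sub_const τ).const_mul (-a)
    exact h1.exp
  have heq : ∀ r, τ < r → r < T → x r = Real.exp (-a * (r - τ)) * (x τ + b * ∫ s in τ..r, Real.exp (a * (s - τ)) * F (x (s - 1))) := by
    intro r h1 h2
    rw [hx τ r h1 h2, mul_add]
    congr 1
    rw [mul_left_comm]
    congr 1
    rw [← intervalIntegral.integral_const_mul]
    apply intervalIntegral.integral_congr
    intro s _
    simp only
    rw [← mul_assoc, ← Real.exp_add]
    congr 2
    ring
  have hmain := hE.fun_mul ((hI.const_mul b).const_add (x τ))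
  have hev : x =ᶠ[𝓝 t] fun r => Real.exp (-a * (r - τ)) * (x τ + b * ∫ s in τ..r, Real.exp (a * (s - τ)) * F (x (s - 1))) := by
    filter_upwards [Ioi_mem_nhds hτt, Iio_mem_nhds ht] with r h1 h2
    exact heq r h1 h2
  refine (hmain.congr_of_eventuallyEq hev).congr_deriv ?_
  have e1 := heq t hτt ht
  have e2 : Real.exp (-a * (t - τ)) * Real.exp (a * (t-τ)) = 1 := by
    rw [← Real.exp_add]; simp
  set I := ∫ s in τ..t, Real.exp (a * (s - τ)) * F (x (s - 1))
  rw [e1]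
  linear_combination b * F (x (t-1)) * e2

theorem extract (y : ℕ → ℝ → ℝ) (M L : ℝ) (hb : ∀ k t, y k t ∈ Icc (0:ℝ) M)
    (hL : ∀ k s t, |y k s - y k t| ≤ L * |s - t|) :
    ∃ ψ : ℕ → ℕ, StrictMono ψ ∧ ∃ z : ℝ → ℝ, ∀ t, Tendsto (fun k => y (ψ k) t) atTop (𝓝 (z t)) := by
  have hcomp : IsCompact (Set.pi univ (fun _ : ℚ => Icc (0:ℝ) M)) :=
    isCompact_univ_pi (fun _ => isCompact_Icc)
  obtain ⟨w, -, ψ, hψ, hlim⟩ := hcomp.tendsto_subseq (x := fun k => fun q : ℚ => y k (q:ℝ))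
    (fun k => by intro q _; exact hb k q)
  rw [tendsto_pi_nhds] at hlim
  have hL0 : 0 ≤ L := by
    have := hL 0 1 0
    simp at this
    exact (abs_nonneg _).trans this
  refine ⟨ψ, hψ, ?_⟩
  have : ∀ t : ℝ, ∃ v, Tendsto (fun k => y (ψ k) t) atTop (𝓝 v) := by
    intro t
    apply cauchySeq_tendsto_of_complete
    rw [Metric.cauchySeq_iff]
    intro ε hε
    have hη : 0 < ε / (4 * (L+1)) := by positivity
    obtain ⟨q, hq1, hq2⟩ := exists_rat_btwn (show t < t + ε / (4 * (L+1)) by linarith)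
    have hc := (hlim q).cauchySeq
    rw [Metric.cauchySeq_iff] at hc
    obtain ⟨N, hN⟩ := hc (ε/2) (by linarith)
    refine ⟨N, fun m hm n hn => ?_⟩
    have h1 := hN m hm n hn
    rw [Real.dist_eq] at h1 ⊢
    simp only [Function.comp] at h1
    have hLq : L * |t - q| ≤ ε/4 := by
      have : |t - q| ≤ ε / (4 * (L+1)) := by rw [abs_le]; constructor <;> linarith
      calc L * |t - q| ≤ (L+1) * (ε / (4 * (L+1))) := by gcongr; linarith
        _ = ε / 4 := by field_simp
    have h2 := (hL (ψ m) t q).trans hLq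
    have h3 := (hL (ψ n) t q).trans hLq
    rw [abs_le] at h2 h3
    rw [abs_lt] at h1 ⊢
    constructor <;> linarith
  choose z hz using this
  exact ⟨z, hz⟩

theorem f_lim {c d : ℝ} {g g' : ℝ → ℝ} (hg : CgA g g') {a b : ℕ → ℝ} {f f' : ℕ → ℝ → ℝ}
    (hf : Cfn c d g g' a b f f') (ν : ℕ → ℕ) (hν : Tendsto ν atTop atTop) (u : ℕ → ℝ) (v : ℝ)
    (hu0 : ∀ k, 0 ≤ u k) (hu : Tendsto u atTop (𝓝 v)) (hv : v ≠ 1) :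
    Tendsto (fun k => f (ν k) (u k)) atTop (𝓝 (g v)) := by
  have hv0 : 0 ≤ v := ge_of_tendsto' hu hu0
  have key : ∃ κ, 0 < κ ∧ κ < 1 ∧ (∀ᶠ k in atTop, u k ∈ Icc (0:ℝ) (1-κ) ∨ 1 + κ ≤ u k) ∧
      Tendsto (fun k => g (u k)) atTop (𝓝 (g v)) := by
    rcases lt_or_gt_of_ne hv with h | h
    · refine ⟨(1-v)/2, by linarith, by linarith, ?_, ?_⟩
      · filter_upwards [hu.eventually_lt_const (show v < 1 - (1-v)/2 by linarith)] with k hk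
        exact Or.inl ⟨hu0 k, hk.le⟩
      · have hcw : ContinuousWithinAt g (Icc 0 1) v := g_contOn hg v ⟨hv0, h.le⟩
        refine hcw.tendsto.comp (tendsto_nhdsWithin_iff.2 ⟨hu, ?_⟩)
        filter_upwards [hu.eventually_lt_const h] with k hk
        exact ⟨hu0 k, hk.le⟩
    · refine ⟨min ((v-1)/2) (1/2), lt_min (by linarith) (by norm_num), (min_le_right _ _).trans_lt (by norm_num), ?_, ?_⟩
      · have : 1 + min ((v-1)/2) (1/2) < v := by
          have := min_le_left ((v-1)/2) (1/2); linarith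
        filter_upwards [hu.eventually_const_lt this] with k hk
        exact Or.inr hk.le
      · rw [hg.eq_zero v h]
        refine tendsto_const_nhds.congr' ?_
        filter_upwards [hu.eventually_const_lt h] with k hk
        exact (hg.eq_zero _ hk).symm
  obtain ⟨κ, hκ0, hκ1, hev, hgl⟩ := key
  have hdiff : Tendsto (fun k => f (ν k) (u k) - g (u k)) atTop (𝓝 0) := by
    rw [Metric.tendsto_nhds]
    intro ε hε
    obtain ⟨N, hN⟩ := hf.close κ hκ0 hκ1 ε hε
    filter_upwards [hev, hν.eventually_ge_atTop N] with k h1 h2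
    have := hN (ν k) h2 (u k) h1
    rw [Real.dist_eq, sub_zero]
    linarith [abs_nonneg (f' (ν k) (u k) - g' (u k))]
  simpa using hdiff.add hgl

theorem int_lim {c d : ℝ} {g g' : ℝ → ℝ} (hg : CgA g g') {a b : ℕ → ℝ} {f f' : ℕ → ℝ → ℝ}
    (hf : Cfn c d g g' a b f f') (ν : ℕ → ℕ) (hν : Tendsto ν atTop atTop) (y : ℕ → ℝ → ℝ) (z : ℝ → ℝ)
    (hy : ∀ k, IsSolR (a (ν k)) (b (ν k)) (f (ν k)) (y k)) (τ t : ℝ) (hτt : τ < t)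
    (hz : ∀ s, s ≤ t → Tendsto (fun k => y k s) atTop (𝓝 (z s)))
    (hne : ∀ᵐ s, s ∈ uIoc τ t → z (s-1) ≠ 1) :
    z t = Real.exp (-c * (t - τ)) * z τ
          + d * ∫ s in τ..t, Real.exp (-c * (t - s)) * g (z (s - 1)) := by
  have ha : Tendsto (fun k => a (ν k)) atTop (𝓝 c) := hf.a_lim.comp hν
  have hb : Tendsto (fun k => b (ν k)) atTop (𝓝 d) := hf.b_lim.comp hν
  have hI : Tendsto (fun k => ∫ s in τ..t, Real.exp (-a (ν k) * (t - s)) * f (ν k) (y k (s - 1))) atTop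
      (𝓝 (∫ s in τ..t, Real.exp (-c * (t - s)) * g (z (s - 1)))) := by
    apply intervalIntegral.tendsto_integral_filter_of_dominated_convergence (fun _ => 1)
    · refine Eventually.of_forall (fun k => ?_)
      have := ((hy k).2.2 τ t hτt).1
      rw [intervalIntegrable_iff] at this
      exact this.aestronglyMeasurable
    · refine Eventually.of_forall (fun k => ae_of_all _ (fun s hs => ?_))
      rw [uIoc_of_le hτt.le] at hs
      have h1 := hf.maps_to (ν k) (y k (s-1)) ((hy k).2.1 _)
      have h2 : Real.exp (-a (ν k) * (t-s)) ≤ 1 := by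
        rw [Real.exp_le_one_iff]
        nlinarith [hf.a_pos (ν k), hs.2]
      rw [Real.norm_eq_abs, abs_of_nonneg (mul_nonneg (Real.exp_pos _).le h1.1)]
      exact mul_le_one₀ h2 h1.1 h1.2.le
    · exact intervalIntegrable_const
    · filter_upwards [hne] with s hs hs'
      have h1 := f_lim hg hf ν hν (fun k => y k (s-1)) (z (s-1)) (fun k => (hy k).2.1 _)
        (hz _ (by rw [uIoc_of_le hτt.le] at hs'; linarith [hs'.2])) (hs hs')
      refine Tendsto.mul ?_ h1
      exact (Real.continuous_exp.tendsto _).comp (ha.neg.mul_const (t-s))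
  have hE : Tendsto (fun k => Real.exp (-a (ν k) * (t - τ))) atTop (𝓝 (Real.exp (-c * (t - τ)))) :=
    (Real.continuous_exp.tendsto _).comp (ha.neg.mul_const (t-τ))
  have hR := (hE.mul (hz τ hτt.le)).add (hb.mul hI)
  refine tendsto_nhds_unique (hz t le_rfl) (hR.congr (fun k => ?_))
  exact ((hy k).2.2 τ t hτt).2.symm

theorem sol_bounds {c d : ℝ} {g g' : ℝ → ℝ} {a b : ℕ → ℝ} {f f' : ℕ → ℝ → ℝ}
    (hf : Cfn c d g g' a b f f') (n : ℕ) (y : ℝ → ℝ) (hy : IsSolR (a n) (b n) (f n) y) (τ t : ℝ) (hτt : τ ≤ t) :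
    y t - y τ ≤ b n * (t - τ) ∧ y τ - y t ≤ a n * (t - τ) * y τ := by
  rcases hτt.eq_or_lt with h | hlt
  · rw [h]; simp
  obtain ⟨h1, h2⟩ := hy.2.2 τ t hlt
  have ha := hf.a_pos n
  have hb := hf.b_pos n
  have hbd : ∀ s ∈ Icc τ t, 0 ≤ Real.exp (-a n * (t - s)) * f n (y (s - 1)) ∧
      Real.exp (-a n * (t - s)) * f n (y (s - 1)) ≤ 1 := by
    intro s hs
    have h1 := hf.maps_to n (y (s-1)) (hy.2.1 _)
    have h2 : Real.exp (-a n * (t-s)) ≤ 1 := by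
      rw [Real.exp_le_one_iff]
      nlinarith [hs.2]
    exact ⟨mul_nonneg (Real.exp_pos _).le h1.1, mul_le_one₀ h2 h1.1 h1.2.le⟩
  have i0 : 0 ≤ ∫ s in τ..t, Real.exp (-a n * (t - s)) * f n (y (s - 1)) :=
    intervalIntegral.integral_nonneg hτt (fun s hs => (hbd s hs).1)
  have i1 : ∫ s in τ..t, Real.exp (-a n * (t - s)) * f n (y (s - 1)) ≤ t - τ := by
    have := intervalIntegral.integral_mono_on hτt h1 (intervalIntegrable_const (c := (1:ℝ))) (fun s hs => (hbd s hs).2)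
    simpa using this
  have e1 : Real.exp (-a n * (t - τ)) ≤ 1 := by
    rw [Real.exp_le_one_iff]; nlinarith
  have e2 := Real.add_one_le_exp (-a n * (t-τ))
  have hyt := hy.2.1 τ
  have j0 := mul_nonneg hb.le i0
  have j1 := mul_le_mul_of_nonneg_left i1 hb.le
  have j2 := mul_le_mul_of_nonneg_right e1 hyt
  have j3 := mul_le_mul_of_nonneg_right e2 hyt
  constructor <;> linarith


/-- points where the limit solution equals one -/
theorem xp_one (c d : ℝ) (g g' : ℝ → ℝ) (hg : CgA g g')
    (hc : 0 < c) (hcd : c < d)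
    (xp : ℝ → ℝ) (hxp : IsSolR c d g xp)
    (t₁ t₂ : ℝ) (hxt₁ : xp t₁ = 1)
    (hmono : StrictMonoOn xp (Iic (t₁ + 1)))
    (ht₂ : t₂ = t₁ + 1 + (1 / c) * Real.log (xp (t₁ + 1)))
    (m : ℝ) (hlt : ∀ t : ℝ, t₂ < t → t ≤ m → xp t < 1) :
    ∀ s, s ≤ m → xp s = 1 → s = t₁ ∨ s = t₂ := by
  intro s hs h1
  have hd : 0 < d := hc.trans hcd
  by_contra hcon
  push Not at hcon
  obtain ⟨n1, n2⟩ := hcon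
  rcases le_or_gt s (t₁+1) with h | h
  · exact n1 (hmono.injOn h (show t₁ ∈ Iic (t₁+1) by simp) (h1.trans hxt₁.symm))
  · rcases lt_or_ge t₂ s with h2 | h2
    · exact absurd h1 (hlt s h2 hs).ne
    have h2 : s < t₂ := lt_of_le_of_ne h2 n2
    have hX : 1 < xp (t₁+1) := by
      refine hxt₁.symm.trans_lt ?_
      exact hmono (show t₁ ∈ Iic (t₁+1) by simp) (show t₁+1 ∈ Iic (t₁+1) by simp) (by linarith)
    have hI := (hxp.2.2 (t₁+1) s h).2
    have hnn : 0 ≤ ∫ r in (t₁+1)..s, Real.exp (-c * (s - r)) * g (xp (r - 1)) := by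
      apply intervalIntegral.integral_nonneg h.le
      intro r _
      exact mul_nonneg (Real.exp_pos _).le (hg.maps_to _ (hxp.2.1 _)).1
    have h3 : c * (s - (t₁+1)) < Real.log (xp (t₁+1)) := by
      have : s - (t₁+1) < 1/c * Real.log (xp (t₁+1)) := by linarith
      have := mul_lt_mul_of_pos_left this hc
      field_simp at this
      linarith
    have h4 : 1 < Real.exp (-c * (s - (t₁+1))) * xp (t₁+1) := by
      have e1 := Real.exp_log (show 0 < xp (t₁+1) by linarith)
      have e2 : Real.exp (-c * (s - (t₁+1))) * xp (t₁+1)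
          = Real.exp (-c * (s - (t₁+1)) + Real.log (xp (t₁+1))) := by
        rw [Real.exp_add, e1]
      rw [e2]
      apply Real.one_lt_exp_iff.2
      linarith
    have := mul_nonneg hd.le hnn
    linarith

/-- identification of the limit for negative times -/
theorem lim_neg (c d : ℝ) (g g' : ℝ → ℝ) (hg : CgA g g')
    (hc : 0 < c) (hcd : c < d)
    (ξ₁ : ℝ) (hξ₁ : ξ₁ ∈ Ioo (0:ℝ) 1) (hz₁ : -c * ξ₁ + d * g ξ₁ = 0)
    (κp : ℝ) (hκp : κp ∈ Ioo 0 (1 - ξ₁))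
    (xp : ℝ → ℝ) (hxp : IsSolR c d g xp) (hxp0 : xp 0 = ξ₁ + κp)
    (hxpb : ∀ t : ℝ, t ≤ 0 → ξ₁ ≤ xp t ∧ xp t ≤ xp 0)
    (t₁ : ℝ) (ht₁ : 0 < t₁) (hxt₁ : xp t₁ = 1)
    (hmono : StrictMonoOn xp (Iic (t₁ + 1)))
    (z : ℝ → ℝ) (hzc : ContinuousOn z (Iic 0)) (hz0 : z 0 = ξ₁ + κp)
    (hzb : ∀ t, t ≤ 0 → ξ₁ ≤ z t ∧ z t ≤ ξ₁ + κp)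
    (hzi : ∀ τ t, τ < t → t < 1 → z t = Real.exp (-c * (t - τ)) * z τ
          + d * ∫ s in τ..t, Real.exp (-c * (t - s)) * g (z (s - 1))) :
    ∀ t, t ≤ 0 → z t = xp t := by
  have hκ1 : ξ₁ + κp < 1 := by linarith [hκp.2]
  have hlow : ∀ t, t ≤ t₁ + 1 → ξ₁ ≤ xp t := by
    intro t ht
    rcases le_or_gt t 0 with h | h
    · exact (hxpb t h).1
    · exact (hxpb 0 le_rfl).1.trans (hmono (show (0:ℝ) ≤ t₁+1 by linarith) ht h).le
  have hgc : ∀ ξ, ξ₁ ≤ ξ → ξ < 1 → ContinuousAt g ξ := fun ξ h1 h2 =>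
    (g_hasDerivAt hg ξ (hξ₁.1.trans_le h1) h2).continuousAt
  have hxd := deriv_of_int c d (1 + t₁) g xp (by
    intro s hs
    have hs : s < 1 + t₁ := hs
    refine ContinuousAt.continuousWithinAt ?_
    refine ContinuousAt.comp (g := g) (f := fun s => xp (s-1)) (hgc _ (hlow _ (by linarith)) ?_)
      (hxp.1.comp (by fun_prop)).continuousAt
    refine lt_of_lt_of_eq ?_ hxt₁
    exact hmono (show s - 1 ≤ t₁+1 by linarith) (show t₁ ≤ t₁+1 by linarith) (by linarith))
    (fun τ t h _ => (hxp.2.2 τ t h).2)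
  have hzd := deriv_of_int c d 1 g z (by
    intro s hs
    have hs : s < 1 := hs
    refine ContinuousAt.continuousWithinAt ?_
    have hb := hzb (s-1) (by linarith)
    refine ContinuousAt.comp (g := g) (f := fun s => z (s-1)) (hgc _ hb.1 (by linarith)) ?_
    refine ContinuousAt.comp (g := z) (f := fun s : ℝ => s-1) ?_ (by fun_prop)
    exact hzc.continuousAt (Iic_mem_nhds (by linarith))) hzi
  obtain ⟨μ, Q, hμ, hQ, hL, hgr⟩ := g_facts hg c d ξ₁ κp hc hcd hξ₁ hz₁ hκ1
  intro t ht
  have := uniq c μ Q κp hc hμ hQ hκp.1 (fun w => d * (g (ξ₁ + w) - g ξ₁)) (fun t => xp t - ξ₁)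
    (fun t => z t - ξ₁) (by simp) hL hgr
    (by
      intro s hs r hr hsr
      have hs : s ≤ 1 := hs
      have hr : r ≤ 1 := hr
      have := hmono (show s ≤ t₁+1 by linarith) (show r ≤ t₁+1 by linarith) hsr
      show xp s - ξ₁ < xp r - ξ₁
      linarith)
    (by linarith)
    (by intro t ht; have := hlow t (by linarith); linarith)
    (by
      intro t ht
      refine ((hxd t (by linarith)).sub_const ξ₁).congr_deriv ?_
      simp only [add_sub_cancel]
      linarith)
    (by
      intro t ht
      refine ((hzd t (by linarith)).sub_const ξ₁).congr_deriv ?_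
      simp only [add_sub_cancel]
      linarith)
    (by intro t ht; have := hzb t ht; constructor <;> linarith)
    (by linarith) t ht

  linarith

/-- identification of the limit up to time `m` -/
theorem lim_all {c d : ℝ} {g g' : ℝ → ℝ} (hg : CgA g g') {a b : ℕ → ℝ} {f f' : ℕ → ℝ → ℝ}
    (hf : Cfn c d g g' a b f f') (ν : ℕ → ℕ) (hν : Tendsto ν atTop atTop) (y : ℕ → ℝ → ℝ) (z : ℝ → ℝ)
    (hy : ∀ k, IsSolR (a (ν k)) (b (ν k)) (f (ν k)) (y k)) (m : ℝ)
    (hz : ∀ s, s ≤ m → Tendsto (fun k => y k s) atTop (𝓝 (z s)))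
    (xp : ℝ → ℝ) (hxp : IsSolR c d g xp) (t₁ t₂ : ℝ)
    (hone : ∀ s, s ≤ m → xp s = 1 → s = t₁ ∨ s = t₂)
    (h0 : ∀ t, t ≤ 0 → z t = xp t) (k : ℕ) : ∀ t, t ≤ m → t ≤ k → z t = xp t := by
  induction k with
  | zero => intro t _ ht; exact h0 t (by simpa using ht)
  | succ k ih =>
    intro t htm ht
    push_cast at ht
    rcases le_or_gt t k with h | h
    · exact ih t htm h
    have hnull : ∀ᵐ s : ℝ, s ≠ t₁ + 1 ∧ s ≠ t₂ + 1 :=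
      (Measure.ae_ne volume (t₁+1)).and (Measure.ae_ne volume (t₂+1))
    have hI := int_lim hg hf ν hν y z hy k t h (fun s hs => hz s (hs.trans htm)) (by
      filter_upwards [hnull] with s hs hmem hc1
      rw [uIoc_of_le h.le] at hmem
      rw [ih (s-1) (by linarith [hmem.2]) (by linarith [hmem.2])] at hc1
      rcases hone (s-1) (by linarith [hmem.2]) hc1 with h1 | h1
      · exact hs.1 (by linarith)
      · exact hs.2 (by linarith))
    rw [hI, (hxp.2.2 k t h).2, ih k (by linarith) le_rfl]
    congr 2
    apply intervalIntegral.integral_congr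
    intro s hs
    rw [uIcc_of_le h.le] at hs
    simp only
    rw [ih (s-1) (by linarith [hs.2]) (by linarith [hs.2])]

/-- under condition `(Y_n)`, the solutions `Y^{+,n,j}` converge to `x⁺`
uniformly on `[0,m]` and uniformly in `j ∈ J_n`. -/
theorem stmt_18 {ι : Type*} (c d : ℝ) (g g' : ℝ → ℝ) (hg : CgA g g')
    (hc : 0 < c) (hcd : c < d)
    (a b : ℕ → ℝ) (f f' : ℕ → ℝ → ℝ) (hf : Cfn c d g g' a b f f')
    (ξ₁ : ℝ) (hξ₁ : ξ₁ ∈ Ioo (0:ℝ) 1) (hz₁ : -c * ξ₁ + d * g ξ₁ = 0)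
    (κp : ℝ) (hκp : κp ∈ Ioo 0 (1 - ξ₁))
    (ξ1n : ℕ → ℝ) (hξ1n : Tendsto ξ1n atTop (nhds ξ₁))
    (hξ1nz : ∀ᶠ n in atTop, 0 < ξ1n n ∧ -a n * ξ1n n + b n * f n (ξ1n n) = 0)
    (xp : ℝ → ℝ) (hxp : IsSolR c d g xp) (hxp0 : xp 0 = ξ₁ + κp)
    (hxpb : ∀ t : ℝ, t ≤ 0 → ξ₁ ≤ xp t ∧ xp t ≤ xp 0)
    (t₁ t₂ : ℝ) (ht₁ : 0 < t₁) (hxt₁ : xp t₁ = 1)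
    (hmono : StrictMonoOn xp (Iic (t₁ + 1)))
    (ht₂ : t₂ = t₁ + 1 + (1 / c) * Real.log (xp (t₁ + 1))) (hxt₂ : xp t₂ = 1)
    (ε : ℕ → ℝ) (hε : ∀ n, 0 ≤ ε n) (hεlim : Tendsto ε atTop (nhds 0))
    (J : ℕ → Set ι) (Y : ℕ → ι → ℝ → ℝ)
    (hY : ∀ n, ∀ j ∈ J n, IsSolR (a n) (b n) (f n) (Y n j))
    (hY0 : ∀ n, ∀ j ∈ J n, Y n j 0 = κp + ξ1n n)
    (hYb : ∀ n, ∀ j ∈ J n, ∀ t : ℝ, t < 0 →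
        ξ1n n - ε n ≤ Y n j t ∧ Y n j t ≤ κp + ξ1n n)
    (m : ℕ) (hm : t₂ < m)
    (hlt : ∀ t : ℝ, t₂ < t → t ≤ m → xp t < 1) :
    ∀ δ : ℝ, 0 < δ → ∃ N : ℕ, ∀ n ≥ N, ∀ j ∈ J n,
      ∀ t ∈ Icc (0:ℝ) (m : ℝ), |Y n j t - xp t| < δ := by
  by_contra hcon
  push Not at hcon
  obtain ⟨δ, hδ, hcon⟩ := hcon
  have hd : 0 < d := hc.trans hcd
  have hm0 : (0:ℝ) < m := by
    have h1 : 1 < xp (t₁+1) := by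
      refine hxt₁.symm.trans_lt ?_
      exact hmono (show t₁ ≤ t₁+1 by linarith) (show t₁+1 ≤ t₁+1 from le_rfl) (by linarith)
    have h2 : 0 ≤ 1/c * Real.log (xp (t₁+1)) :=
      mul_nonneg (by positivity) (Real.log_nonneg h1.le)
    linarith
  have hone := xp_one c d g g' hg hc hcd xp hxp t₁ t₂ hxt₁ hmono ht₂ m hlt
  have hev : ∀ᶠ n in atTop, a n ≤ c + 1 ∧ b n ≤ d + 1 ∧ κp + ξ1n n ≤ 2 := by
    filter_upwards [hf.a_lim.eventually_lt_const (show c < c+1 by linarith),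
      hf.b_lim.eventually_lt_const (show d < d+1 by linarith),
      hξ1n.eventually_lt_const (show ξ₁ < 2 - κp by linarith [hκp.2])] with n h1 h2 h3
    exact ⟨h1.le, h2.le, by linarith⟩
  obtain ⟨N0, hN0⟩ := eventually_atTop.1 hev
  choose nn hnn jj hjj tt htt hbad using fun k : ℕ => hcon (max k N0)
  have hnn1 : ∀ k, k ≤ nn k := fun k => (le_max_left _ _).trans (hnn k)
  have hnn2 : ∀ k, N0 ≤ nn k := fun k => (le_max_right _ _).trans (hnn k)
  have hnt : Tendsto nn atTop atTop := tendsto_atTop_mono hnn1 tendsto_id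
  set M : ℝ := 2 + (d+1) * m with hM
  have hM0 : 0 ≤ M := by positivity
  set L : ℝ := (d+1) + (c+1) * M with hLdef
  have hL0 : 0 ≤ L := by positivity
  have hsol : ∀ k, IsSolR (a (nn k)) (b (nn k)) (f (nn k)) (Y (nn k) (jj k)) :=
    fun k => hY _ _ (hjj k)
  have hle0 : ∀ k t, t ≤ 0 → Y (nn k) (jj k) t ≤ κp + ξ1n (nn k) := by
    intro k t ht
    rcases ht.lt_or_eq with h | h
    · exact (hYb _ _ (hjj k) t h).2
    · rw [h, hY0 _ _ (hjj k)]
  have hbd : ∀ k, ∀ t : ℝ, t ≤ m → Y (nn k) (jj k) t ∈ Icc 0 M := by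
    intro k t ht
    obtain ⟨h1, h2, h3⟩ := hN0 _ (hnn2 k)
    refine ⟨(hsol k).2.1 t, ?_⟩
    rcases le_or_gt t 0 with h | h
    · have := hle0 k t h
      have : 0 ≤ (d+1) * (m:ℝ) := by positivity
      linarith
    · have e1 := (sol_bounds hf _ _ (hsol k) 0 t h.le).1
      have e2 := hle0 k 0 le_rfl
      have e3 : b (nn k) * (t - 0) ≤ (d+1) * m := by
        apply mul_le_mul h2 (by linarith) (by linarith) (by linarith)
      linarith
  have hlip0 : ∀ k, ∀ s t : ℝ, s ≤ t → t ≤ m →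
      |Y (nn k) (jj k) s - Y (nn k) (jj k) t| ≤ L * (t - s) := by
    intro k s t hst ht
    obtain ⟨h1, h2, h3⟩ := hN0 _ (hnn2 k)
    have e := sol_bounds hf _ _ (hsol k) s t hst
    have hb := hbd k s (hst.trans ht)
    have e1 : b (nn k) * (t - s) ≤ (d+1) * (t-s) :=
      mul_le_mul_of_nonneg_right h2 (by linarith)
    have e2 : a (nn k) * (t - s) * Y (nn k) (jj k) s ≤ (c+1) * (t-s) * M := by
      apply mul_le_mul _ hb.2 hb.1 (mul_nonneg (by linarith) (by linarith))
      exact mul_le_mul_of_nonneg_right h1 (by linarith)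
    have e3 : 0 ≤ (d+1) * (t-s) := mul_nonneg (by linarith) (by linarith)
    have e4 : 0 ≤ (c+1) * (t-s) * M := mul_nonneg (mul_nonneg (by linarith) (by linarith)) hM0
    have e5 : L * (t-s) = (d+1)*(t-s) + (c+1)*(t-s)*M := by rw [hLdef]; ring
    rw [abs_le]
    constructor <;> linarith
  have hlip : ∀ k, ∀ s t : ℝ, s ≤ m → t ≤ m →
      |Y (nn k) (jj k) s - Y (nn k) (jj k) t| ≤ L * |s - t| := by
    intro k s t hs ht
    rcases le_total s t with h | h
    · rw [abs_sub_comm s t, abs_of_nonneg (sub_nonneg.2 h)]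
      exact hlip0 k s t h ht
    · rw [abs_sub_comm, abs_of_nonneg (sub_nonneg.2 h)]
      exact hlip0 k t s h hs
  obtain ⟨ts, hts, φ, hφ, htlim⟩ := isCompact_Icc.tendsto_subseq htt
  obtain ⟨ψ, hψ, z, hz⟩ := extract (fun k t => Y (nn (φ k)) (jj (φ k)) (min t m)) M L
    (fun k t => hbd _ _ (min_le_right _ _))
    (fun k s t => by
      refine (hlip (φ k) _ _ (min_le_right _ _) (min_le_right _ _)).trans ?_
      apply mul_le_mul_of_nonneg_left _ hL0
      have := abs_min_sub_min_le_max s (m:ℝ) t m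
      simpa using this)
  set ω : ℕ → ℕ := fun k => φ (ψ k) with hω
  have hωt : Tendsto ω atTop atTop := (hφ.tendsto_atTop).comp hψ.tendsto_atTop
  set ν : ℕ → ℕ := fun k => nn (ω k) with hν
  have hνt : Tendsto ν atTop atTop := hnt.comp hωt
  set y : ℕ → ℝ → ℝ := fun k => Y (nn (ω k)) (jj (ω k)) with hy
  have hysol : ∀ k, IsSolR (a (ν k)) (b (ν k)) (f (ν k)) (y k) := fun k => hsol _
  have hzlim : ∀ s, s ≤ (m:ℝ) → Tendsto (fun k => y k s) atTop (𝓝 (z s)) := by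
    intro s hs
    have := hz s
    simpa only [min_eq_left hs] using this
  have hξlim : Tendsto (fun k => ξ1n (ν k)) atTop (𝓝 ξ₁) := hξ1n.comp hνt
  have hεl : Tendsto (fun k => ε (ν k)) atTop (𝓝 0) := hεlim.comp hνt
  have hz0 : z 0 = ξ₁ + κp := by
    refine tendsto_nhds_unique (hzlim 0 hm0.le) ?_
    have : Tendsto (fun k => κp + ξ1n (ν k)) atTop (𝓝 (κp + ξ₁)) := hξlim.const_add κp
    rw [add_comm κp] at this
    exact this.congr (fun k => (hY0 _ _ (hjj (ω k))).symm)
  have hzb : ∀ t, t ≤ 0 → ξ₁ ≤ z t ∧ z t ≤ ξ₁ + κp := by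
    intro t ht
    rcases ht.lt_or_eq with h | h
    · constructor
      · have h1 : Tendsto (fun k => ξ1n (ν k) - ε (ν k)) atTop (𝓝 (ξ₁ - 0)) := hξlim.sub hεl
        rw [sub_zero] at h1
        exact le_of_tendsto_of_tendsto' h1 (hzlim t (by linarith))
          (fun k => (hYb _ _ (hjj (ω k)) t h).1)
      · have h1 : Tendsto (fun k => κp + ξ1n (ν k)) atTop (𝓝 (κp + ξ₁)) := hξlim.const_add κp
        rw [add_comm ξ₁]
        exact le_of_tendsto_of_tendsto' (hzlim t (by linarith)) h1
          (fun k => (hYb _ _ (hjj (ω k)) t h).2)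
    · rw [h, hz0]
      exact ⟨by linarith [hκp.1], le_rfl⟩
  have hm1 : (1:ℝ) ≤ m := by
    have : 0 < m := by exact_mod_cast hm0
    exact_mod_cast this
  have hzlip : ∀ s t : ℝ, s ≤ m → t ≤ m → |z s - z t| ≤ L * |s - t| := by
    intro s t hs ht
    exact le_of_tendsto' ((hzlim s hs).sub (hzlim t ht)).abs (fun k => hlip _ s t hs ht)
  have hzc : ContinuousOn z (Iic 0) := by
    have : LipschitzOnWith (Real.toNNReal L) z (Iic 0) := by
      apply LipschitzOnWith.of_dist_le_mul
      intro s hs t ht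
      have hs : s ≤ 0 := hs
      have ht : t ≤ 0 := ht
      rw [Real.dist_eq, Real.dist_eq, Real.coe_toNNReal L hL0]
      exact hzlip s t (by linarith) (by linarith)
    exact this.continuousOn
  have hzi : ∀ τ t, τ < t → t < 1 → z t = Real.exp (-c * (t - τ)) * z τ
          + d * ∫ s in τ..t, Real.exp (-c * (t - s)) * g (z (s - 1)) := by
    intro τ t h1 h2
    apply int_lim hg hf ν hνt y z hysol τ t h1 (fun s hs => hzlim s (by linarith))
    refine Eventually.of_forall (fun s hs => ?_)
    rw [uIoc_of_le h1.le] at hs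
    have := (hzb (s-1) (by linarith [hs.2])).2
    have := hκp.2
    intro h
    linarith
  have hneg := lim_neg c d g g' hg hc hcd ξ₁ hξ₁ hz₁ κp hκp xp hxp hxp0 hxpb t₁ ht₁ hxt₁ hmono
    z hzc hz0 hzb hzi
  have hall := lim_all hg hf ν hνt y z hysol m hzlim xp hxp t₁ t₂ hone hneg m
  have htl : Tendsto (fun k => tt (ω k)) atTop (𝓝 ts) := htlim.comp hψ.tendsto_atTop
  have hx1 : Tendsto (fun k => xp (tt (ω k))) atTop (𝓝 (xp ts)) := (hxp.1.tendsto ts).comp htl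
  have hy1 := hzlim ts hts.2
  rw [hall ts hts.2 hts.2] at hy1
  have hd1 : Tendsto (fun k => L * |tt (ω k) - ts|) atTop (𝓝 0) := by
    have := ((htl.sub_const ts).abs).const_mul L
    simpa using this
  have hd2 : Tendsto (fun k => |y k ts - xp (tt (ω k))|) atTop (𝓝 0) := by
    have := (hy1.sub hx1).abs
    simpa using this
  have hd3 := hd1.add hd2
  rw [add_zero] at hd3
  obtain ⟨k, hk⟩ := (hd3.eventually_lt_const hδ).exists
  have h1 := hbad (ω k)
  have h2 := hlip (ω k) (tt (ω k)) ts (htt (ω k)).2 hts.2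
  have h3 := abs_sub_le (Y (nn (ω k)) (jj (ω k)) (tt (ω k))) (y k ts) (xp (tt (ω k)))
  have h4 : |Y (nn (ω k)) (jj (ω k)) (tt (ω k)) - y k ts| ≤ L * |tt (ω k) - ts| := h2
  linarith
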